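/- Let Γ be a graph with exactly two vertices u and v, which are non-adjacent (each possibly looped). Then there exist a finite set W ⊆ {u,v}* and a monoid morphism φ : (W ∪ W̄)* → X_Γ* with φ(w) ∈ X_Γ (a single letter) for every w ∈ W and φ(w̄) = φ(w)‾ for every w ∈ W, such that for all y ∈ X_Γ*: y ≡_{Γ°} ε if and only if there exists x ∈ (W ∪ W̄)* with x ≡_Γ ε and φ(x) = y. Here Γ° is Γ with self-loops added to all vertices. -/

import Mathlib

open scoped Classical

/-- An undirected graph (finite in applications), with self-loops allowed:
`adj v v` means that `v` is looped. -/
structure GGraph (V : Type) where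
  adj : V → V → Prop
  symm : ∀ u v, adj u v → adj v u

namespace ValencePaper

variable {V Q : Type}

/-- The alphabet `X_Γ = V ∪ V̄`: `Sum.inl v` is the letter `v`,
`Sum.inr v` is the letter `v̄`. -/
abbrev XLetter (V : Type) := V ⊕ V

/-- Words over `X_Γ`. -/
abbrev GWord (V : Type) := List (XLetter V)

/-- The bar operation on letters, swapping `v` and `v̄`. -/
def barL : XLetter V → XLetter V := Sum.elim Sum.inr Sum.inl

/-- The inverse word `w̄`. -/
def barW (w : GWord V) : GWord V := (w.map barL).reverse

/-- The vertex a letter refers to. -/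
def vtx : XLetter V → V := Sum.elim id id

/-- One-step rewriting `s u t →_R s v t` for a set of rules `R`. -/
inductive RStep {α : Type} (R : Set (List α × List α)) : List α → List α → Prop
  | intro (s t : List α) {a b : List α} (h : (a, b) ∈ R) :
      RStep R (s ++ a ++ t) (s ++ b ++ t)

/-- The rule set `R_Γ`: cancellation `v v̄ → ε` and commutation `xy → yx`
for letters over adjacent vertices. -/
def GRules (Γ : GGraph V) : Set (GWord V × GWord V) :=
  {p | ∃ v : V, p = ([Sum.inl v, Sum.inr v], [])} ∪
  {p | ∃ (a b : V) (x y : XLetter V),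
      (x = Sum.inl a ∨ x = Sum.inr a) ∧ (y = Sum.inl b ∨ y = Sum.inr b) ∧
      Γ.adj a b ∧ p = ([x, y], [y, x])}

/-- The congruence `≡_Γ`: the smallest equivalence relation containing `→_Γ`. -/
def GEquiv (Γ : GGraph V) : GWord V → GWord V → Prop :=
  Relation.EqvGen (RStep (GRules Γ))

/-- The graph monoid `MΓ = X_Γ*/≡_Γ`. -/
def GMonoid (Γ : GGraph V) := Quot (RStep (GRules Γ))

/-- The class `[w]` of a word `w` in `MΓ`. -/
def gmk (Γ : GGraph V) (w : GWord V) : GMonoid Γ := Quot.mk _ w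

/-- Runs of a valence system with transition set `E`: `Run E p w q` means
there is a sequence of transitions from `p` to `q` whose labels concatenate to `w`. -/
inductive Run (E : Set (Q × GWord V × Q)) : Q → GWord V → Q → Prop
  | nil (q : Q) : Run E q [] q
  | cons {p : Q} {w : GWord V} {q : Q} {u : GWord V} {r : Q} :
      (p, w, q) ∈ E → Run E q u r → Run E p (w ++ u) r

/-- A transition set is bidirected if for any transition `p →w q`
it also contains the transition `q →w̄ p`. -/
def Bidirected (E : Set (Q × GWord V × Q)) : Prop :=
  ∀ p w q, (p, w, q) ∈ E → (q, barW w, p) ∈ E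

/-- Every vertex of `Γ` carries a self-loop. -/
def Looped (Γ : GGraph V) : Prop := ∀ v, Γ.adj v v

/-- `Γ°`: the graph `Γ` with self-loops added on all vertices. -/
def loopify (Γ : GGraph V) : GGraph V :=
  ⟨fun a b => Γ.adj a b ∨ a = b, by
    intro u v h
    rcases h with h | h
    · exact Or.inl (Γ.symm u v h)
    · exact Or.inr h.symm⟩

end ValencePaper

namespace ValencePaper

variable {V : Type}

/-- The word denoted by a signed block `(w, true) ↦ w`, `(w, false) ↦ w̄`.
A word `x ∈ (W ∪ W̄)*` is presented by a list of signed blocks with first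
components in `W`. -/
def blockWord (p : GWord V × Bool) : GWord V := if p.2 then p.1 else barW p.1

/-- The image of a signed block under the morphism `φ` determined by a
letter-valued function `g` on `W` (so `φ(w) = g w ∈ X_Γ` for `w ∈ W`, and
`φ(w̄) = φ(w)‾`). -/
def blockImg (g : GWord V → XLetter V) (p : GWord V × Bool) : GWord V :=
  if p.2 then [g p.1] else [barL (g p.1)]

/-- `φ` (determined by `g` on the blocks `W ∪ W̄`) witnesses the simulation:
for all `y ∈ X_Γ*`, `y ≡_{Γ°} ε` iff there is `x ∈ (W ∪ W̄)*` (given by a list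
of signed blocks over `W`) with `x ≡_Γ ε` and `φ(x) = y`. -/
def SimulatesLoopify (Γ : GGraph V) (W : Set (GWord V)) (g : GWord V → XLetter V) : Prop :=
  ∀ y : GWord V, GEquiv (loopify Γ) y [] ↔
    ∃ parts : List (GWord V × Bool), (∀ p ∈ parts, p.1 ∈ W) ∧
      GEquiv Γ (parts.map blockWord).flatten [] ∧
      (parts.map (blockImg g)).flatten = y

end ValencePaper

open ValencePaper

namespace ValencePaper

variable {V : Type}

@[simp]
theorem barL_inl (a : V) : barL (Sum.inl a : XLetter V) = Sum.inr a := rfl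

@[simp]
theorem barL_inr (a : V) : barL (Sum.inr a : XLetter V) = Sum.inl a := rfl

/-! ### The congruence of a graph -/

theorem GEquiv.refl (Γ : GGraph V) (w : GWord V) : GEquiv Γ w w := Relation.EqvGen.refl w

theorem GEquiv.trans {Γ : GGraph V} {a b c : GWord V} (h₁ : GEquiv Γ a b) (h₂ : GEquiv Γ b c) :
    GEquiv Γ a c := Relation.EqvGen.trans _ _ _ h₁ h₂

theorem GEquiv.of_rule {Γ : GGraph V} {a b : GWord V} (h : (a, b) ∈ GRules Γ) :
    GEquiv Γ a b := by
  simpa [GEquiv] using Relation.EqvGen.rel _ _ (RStep.intro [] [] h)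

theorem GEquiv.append_both {Γ : GGraph V} {a b : GWord V} (h : GEquiv Γ a b) (s t : GWord V) :
    GEquiv Γ (s ++ a ++ t) (s ++ b ++ t) := by
  induction h with
  | rel _ _ h =>
    obtain ⟨s', t', h⟩ := h
    simpa [GEquiv] using Relation.EqvGen.rel _ _ (RStep.intro (s ++ s') (t' ++ t) h)
  | refl => exact GEquiv.refl _ _
  | symm _ _ _ ih => exact ih.symm
  | trans _ _ _ _ _ ih₁ ih₂ => exact ih₁.trans ih₂

/-- A word function that is constant on the rules, in every context, is constant on
congruence classes. -/
theorem GEquiv.apply_eq {α : Type*} {Γ : GGraph V} (f : GWord V → α)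
    (hf : ∀ a b s t, (a, b) ∈ GRules Γ → f (s ++ a ++ t) = f (s ++ b ++ t))
    {a b : GWord V} (h : GEquiv Γ a b) : f a = f b := by
  induction h with
  | rel _ _ h => obtain ⟨s, t, h⟩ := h; exact hf _ _ s t h
  | refl => rfl
  | symm _ _ _ ih => exact ih.symm
  | trans _ _ _ _ _ ih₁ ih₂ => exact ih₁.trans ih₂

theorem gequiv_inl_inr (Γ : GGraph V) (a : V) :
    GEquiv Γ [Sum.inl a, Sum.inr a] [] :=
  GEquiv.of_rule (Or.inl ⟨a, rfl⟩)

theorem gequiv_inr_inl {Γ : GGraph V} {a : V} (h : Γ.adj a a) :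
    GEquiv Γ [Sum.inr a, Sum.inl a] [] :=
  (GEquiv.of_rule (Or.inr ⟨a, a, _, _, Or.inr rfl, Or.inl rfl, h, rfl⟩)).trans
    (gequiv_inl_inr Γ a)

theorem gequiv_append_barW (Γ : GGraph V) (w : List V) :
    GEquiv Γ (w.map Sum.inl ++ barW (w.map Sum.inl)) [] := by
  induction w with
  | nil => exact GEquiv.refl _ _
  | cons a w ih =>
    have h := (ih.append_both [Sum.inl a] [Sum.inr a]).trans (by simpa using gequiv_inl_inr Γ a)
    simpa [barW] using h

/-! ### Evaluation in the free group -/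

/-- A letter as a generator or the inverse of a generator of the free group. -/
def signedLetter : XLetter V → V × Bool := Sum.elim (·, true) (·, false)

/-- The value of a word in the free group over the vertices. -/
def freeValue (w : GWord V) : FreeGroup V := FreeGroup.mk (w.map signedLetter)

@[simp]
theorem freeValue_nil : freeValue ([] : GWord V) = 1 := rfl

@[simp]
theorem freeValue_append (a b : GWord V) : freeValue (a ++ b) = freeValue a * freeValue b := by
  simp [freeValue, FreeGroup.mul_mk]

theorem freeValue_cons (x : XLetter V) (w : GWord V) :
    freeValue (x :: w) = freeValue [x] * freeValue w :=
  freeValue_append [x] w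

theorem freeValue_barL (x : XLetter V) : freeValue [barL x] = (freeValue [x])⁻¹ := by
  cases x <;> simp [freeValue, signedLetter, FreeGroup.inv_mk, FreeGroup.invRev]

/-- Words that are trivial in the free group arise from `ε` by inserting pairs `x x̄`. -/
theorem freeValue_eq_one_induction {P : GWord V → Prop} (nil : P [])
    (insert : ∀ s t x, P (s ++ t) → P (s ++ [x, barL x] ++ t))
    {w : GWord V} (hw : freeValue w = 1) : P w := by
  let f : V × Bool → XLetter V := fun p => if p.2 then Sum.inl p.1 else Sum.inr p.1
  have hf : (w.map signedLetter).map f = w := by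
    have : f ∘ signedLetter = id := by funext x; cases x <;> rfl
    simp [this]
  have hred : FreeGroup.Red (w.map signedLetter) [] := by
    obtain ⟨c, h₁, h₂⟩ := FreeGroup.Red.exact.1 (hw.trans FreeGroup.one_eq_mk)
    rwa [FreeGroup.Red.nil_iff.1 h₂] at h₁
  have key : ∀ L, FreeGroup.Red L [] → P (L.map f) := by
    intro L hL
    induction hL using Relation.ReflTransGen.head_induction_on with
    | refl => exact nil
    | head h _ ih =>
      obtain @⟨L₁, L₂, a, b⟩ := h
      have h := insert (L₁.map f) (L₂.map f) (f (a, b)) (by simpa using ih)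
      cases b <;> simpa [f] using h
  exact hf ▸ key _ hred

theorem freeValue_eq_of_gequiv {Γ : GGraph V} (hΓ : ∀ a b, Γ.adj a b → a = b)
    {a b : GWord V} (h : GEquiv Γ a b) : freeValue a = freeValue b := by
  refine h.apply_eq freeValue fun a b s t hab => ?_
  have : freeValue a = freeValue b := by
    rcases hab with ⟨c, h⟩ | ⟨c, d, x, y, hx, hy, hcd, h⟩
    · obtain ⟨rfl, rfl⟩ := Prod.mk.inj h
      rw [freeValue_cons, ← barL_inl, freeValue_barL]; simp
    · obtain ⟨rfl, rfl⟩ := Prod.mk.inj h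
      obtain rfl := hΓ _ _ hcd
      rw [freeValue_cons, freeValue_cons y [x]]
      rcases hx with rfl | rfl <;> rcases hy with rfl | rfl <;>
        simp [← barL_inl, freeValue_barL]
  simp [this]

theorem gequiv_nil_iff_freeValue_eq_one {Γ : GGraph V} (hΓ : ∀ a b, Γ.adj a b ↔ a = b)
    {w : GWord V} : GEquiv Γ w [] ↔ freeValue w = 1 := by
  refine ⟨fun h => freeValue_eq_of_gequiv (fun a b => (hΓ a b).1) h, fun h => ?_⟩
  refine freeValue_eq_one_induction (P := fun w => GEquiv Γ w []) (GEquiv.refl _ _) ?_ h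
  intro s t x ih
  refine GEquiv.trans (GEquiv.append_both (b := []) ?_ s t) (by simpa using ih)
  cases x with
  | inl a => exact gequiv_inl_inr Γ a
  | inr a => exact gequiv_inr_inl ((hΓ a a).2 rfl)

/-! ### Simulations -/

/-- The letter to which the morphism determined by `g` sends a signed block. -/
def blockLetter (g : GWord V → XLetter V) (p : GWord V × Bool) : XLetter V :=
  if p.2 then g p.1 else barL (g p.1)

theorem flatten_map_blockImg (g : GWord V → XLetter V) (parts : List (GWord V × Bool)) :
    (parts.map (blockImg g)).flatten = parts.map (blockLetter g) := by
  induction parts with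
  | nil => rfl
  | cons p parts ih =>
    simp only [List.map_cons, List.flatten_cons, ih, blockImg, blockLetter]
    split <;> rfl

/-- Every word that is trivial in the free group has a trivial preimage, provided each `x x̄`
does. -/
theorem exists_parts_of_freeValue_eq_one {Γ : GGraph V} {W : Set (GWord V)}
    {g : GWord V → XLetter V}
    (hpair : ∀ x : XLetter V, ∃ p q : GWord V × Bool, p.1 ∈ W ∧ q.1 ∈ W ∧
      GEquiv Γ (blockWord p ++ blockWord q) [] ∧ blockLetter g p = x ∧ blockLetter g q = barL x)
    {y : GWord V} (hy : freeValue y = 1) :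
    ∃ parts : List (GWord V × Bool), (∀ p ∈ parts, p.1 ∈ W) ∧
      GEquiv Γ (parts.map blockWord).flatten [] ∧ parts.map (blockLetter g) = y := by
  refine freeValue_eq_one_induction (P := fun y => ∃ parts : List (GWord V × Bool),
    (∀ p ∈ parts, p.1 ∈ W) ∧ GEquiv Γ (parts.map blockWord).flatten [] ∧
      parts.map (blockLetter g) = y) ⟨[], by simp, GEquiv.refl _ _, rfl⟩ ?_ hy
  rintro s t x ⟨parts, hW, heq, himg⟩
  obtain ⟨l, r, rfl, rfl, rfl⟩ := List.map_eq_append_iff.1 himg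
  obtain ⟨p, q, hp, hq, hpq, rfl, hqx⟩ := hpair x
  refine ⟨l ++ [p, q] ++ r, ?_, ?_, by simp [hqx]⟩
  · intro b hb
    simp only [List.mem_append, List.mem_cons, List.not_mem_nil, or_false] at hb
    rcases hb with (hb | rfl | rfl) | hb
    · exact hW b (by simp [hb])
    · exact hp
    · exact hq
    · exact hW b (by simp [hb])
  · have h := hpq.append_both (l.map blockWord).flatten (r.map blockWord).flatten
    refine GEquiv.trans ?_ (h.trans ?_)
    · simpa using GEquiv.refl _ _
    · simpa using heq

theorem simulatesLoopify_of {Γ : GGraph V} (hΓ : ∀ a b, Γ.adj a b → a = b)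
    {W : Set (GWord V)} {g : GWord V → XLetter V}
    (hpair : ∀ x : XLetter V, ∃ p q : GWord V × Bool, p.1 ∈ W ∧ q.1 ∈ W ∧
      GEquiv Γ (blockWord p ++ blockWord q) [] ∧ blockLetter g p = x ∧ blockLetter g q = barL x)
    (hsound : ∀ parts : List (GWord V × Bool), (∀ p ∈ parts, p.1 ∈ W) →
      GEquiv Γ (parts.map blockWord).flatten [] → freeValue (parts.map (blockLetter g)) = 1) :
    SimulatesLoopify Γ W g := by
  intro y
  simp only [flatten_map_blockImg]
  rw [gequiv_nil_iff_freeValue_eq_one (Γ := loopify Γ)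
    fun a b => ⟨fun h => h.elim (hΓ a b) id, Or.inr⟩]
  refine ⟨exists_parts_of_freeValue_eq_one hpair, ?_⟩
  rintro ⟨parts, hW, heq, rfl⟩
  exact hsound parts hW heq

/-- If all vertices are looped, single letters can be used as blocks. -/
theorem simulatesLoopify_singletons {Γ : GGraph V} (hΓ : ∀ a b, Γ.adj a b ↔ a = b) (u : V) :
    SimulatesLoopify Γ (Set.range fun a : V => [Sum.inl a]) (fun w => w.headD (Sum.inl u)) := by
  refine simulatesLoopify_of (fun a b => (hΓ a b).1) ?_ ?_
  · rintro (a | a)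
    · exact ⟨([Sum.inl a], true), ([Sum.inl a], false), ⟨a, rfl⟩, ⟨a, rfl⟩,
        gequiv_inl_inr Γ a, rfl, rfl⟩
    · exact ⟨([Sum.inl a], false), ([Sum.inl a], true), ⟨a, rfl⟩, ⟨a, rfl⟩,
        gequiv_inr_inl ((hΓ a a).2 rfl), rfl, rfl⟩
  · intro parts hW h
    rw [← gequiv_nil_iff_freeValue_eq_one hΓ]
    convert h using 1
    rw [← flatten_map_blockImg]
    congr 1
    refine List.map_congr_left fun p hp => ?_
    obtain ⟨w, b⟩ := p
    obtain ⟨a, rfl⟩ := hW _ hp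
    cases b <;> rfl

/-! ### The stack machine -/

/-- The effect of a letter on a state, consisting of a counter and a stack of saved counters:
`u` and `ū` change the counter, any other vertex saves the counter and resets it, and its
inverse restores the last saved counter, provided the current one is zero. -/
noncomputable def stackStep (u : V) : ℤ × List ℤ → XLetter V → Option (ℤ × List ℤ)
  | s, Sum.inl a => if a = u then some (s.1 + 1, s.2) else some (0, s.1 :: s.2)
  | s, Sum.inr a =>
    if a = u then some (s.1 - 1, s.2)
    else if s.1 = 0 then
      match s.2 with
      | [] => none
      | n :: S => some (n, S)
    else none

/-- The effect of a word on a state. -/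
noncomputable def stackRun (u : V) (s : ℤ × List ℤ) (w : GWord V) : Option (ℤ × List ℤ) :=
  w.foldlM (stackStep u) s

theorem stackRun_nil (u : V) (s : ℤ × List ℤ) : stackRun u s [] = some s := rfl

theorem stackRun_cons (u : V) (s : ℤ × List ℤ) (x : XLetter V) (w : GWord V) :
    stackRun u s (x :: w) = (stackStep u s x).bind (stackRun u · w) := by
  simp only [stackRun, List.foldlM_cons]; rfl

theorem stackRun_append (u : V) (s : ℤ × List ℤ) (a b : GWord V) :
    stackRun u s (a ++ b) = (stackRun u s a).bind (stackRun u · b) := by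
  simp only [stackRun, List.foldlM_append]; rfl

theorem stackRun_eq_of_gequiv {Γ : GGraph V} {u : V} (hΓ : ∀ a b, Γ.adj a b → a = u ∧ b = u)
    {a b : GWord V} (h : GEquiv Γ a b) (s : ℤ × List ℤ) : stackRun u s a = stackRun u s b := by
  refine h.apply_eq (stackRun u s) fun a b l r hab => ?_
  have : ∀ s, stackRun u s a = stackRun u s b := by
    rintro ⟨n, S⟩
    rcases hab with ⟨c, h⟩ | ⟨c, d, x, y, hx, hy, hcd, h⟩
    · obtain ⟨rfl, rfl⟩ := Prod.mk.inj h
      by_cases hc : c = u <;> simp [stackRun_cons, stackRun_nil, stackStep, hc]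
    · obtain ⟨rfl, rfl⟩ := Prod.mk.inj h
      obtain ⟨rfl, rfl⟩ := hΓ _ _ hcd
      rcases hx with rfl | rfl <;> rcases hy with rfl | rfl <;>
        simp [stackRun_cons, stackRun_nil, stackStep]
  simp [stackRun_append, this]

theorem stackRun_replicate_inl (u : V) (k : ℕ) (n : ℤ) (S : List ℤ) :
    stackRun u (n, S) (List.replicate k (Sum.inl u)) = some (n + k, S) := by
  induction k generalizing n with
  | zero => simp [stackRun_nil]
  | succ k ih =>
    simp only [List.replicate_succ, stackRun_cons, stackStep, if_true, Option.bind_some, ih]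
    congr 2; push_cast; ring

theorem stackRun_replicate_inr (u : V) (k : ℕ) (n : ℤ) (S : List ℤ) :
    stackRun u (n, S) (List.replicate k (Sum.inr u)) = some (n - k, S) := by
  induction k generalizing n with
  | zero => simp [stackRun_nil]
  | succ k ih =>
    simp only [List.replicate_succ, stackRun_cons, stackStep, if_true, Option.bind_some, ih]
    congr 2; push_cast; ring

/-! ### Encoding letters as blocks -/

/-- The block `v uᵏ v`. -/
def codeBlock (u v : V) (k : ℕ) : GWord V :=
  ([v] ++ List.replicate k u ++ [v]).map Sum.inl

theorem stackRun_codeBlock {u v : V} (huv : v ≠ u) (k : ℕ) (n : ℤ) (S : List ℤ) :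
    stackRun u (n, S) (codeBlock u v k) = some (0, (k : ℤ) :: n :: S) := by
  simp [codeBlock, stackRun_append, stackRun_cons, stackRun_nil, stackStep, huv,
    stackRun_replicate_inl]

theorem barW_codeBlock (u v : V) (k : ℕ) :
    barW (codeBlock u v k) =
      [Sum.inr v] ++ List.replicate k (Sum.inr u) ++ [Sum.inr v] := by
  simp [codeBlock, barW]

theorem stackRun_barW_codeBlock_nil {u v : V} (huv : v ≠ u) (k : ℕ) :
    stackRun u (0, []) (barW (codeBlock u v k)) = none := by
  simp [barW_codeBlock, stackRun_cons, stackStep, huv]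

theorem stackRun_barW_codeBlock_cons {u v : V} (huv : v ≠ u) (k m : ℕ) (n : ℤ) (S : List ℤ) :
    stackRun u (0, (m : ℤ) :: n :: S) (barW (codeBlock u v k)) =
      if m = k then some (n, S) else none := by
  have h : ((m : ℤ) - k = 0) ↔ m = k := by omega
  by_cases hmk : m = k <;>
    simp [barW_codeBlock, stackRun_append, stackRun_cons, stackRun_nil, stackStep, huv,
      stackRun_replicate_inr, h, hmk]

/-- The stack that results from pushing the blocks of the letters of a list, first letter on
top. -/
def stackOf (c : XLetter V → ℕ) (L : GWord V) : List ℤ := L.flatMap fun x => [(c x : ℤ), 0]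

theorem freeValue_eq_one_of_stackRun {u v : V} (huv : v ≠ u) {c : XLetter V → ℕ}
    (hc : Function.Injective c) {g : GWord V → XLetter V}
    (hg : ∀ x, g (codeBlock u v (c x)) = x) (parts : List (GWord V × Bool))
    (hW : ∀ p ∈ parts, p.1 ∈ Set.range fun x => codeBlock u v (c x)) (L : GWord V)
    (h : stackRun u (0, stackOf c L) (parts.map blockWord).flatten = some (0, [])) :
    freeValue L.reverse * freeValue (parts.map (blockLetter g)) = 1 := by
  induction parts generalizing L with
  | nil =>
    cases L with
    | nil => simp
    | cons x L => simp [stackRun_nil, stackOf] at h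
  | cons p parts ih =>
    obtain ⟨w, b⟩ := p
    obtain ⟨x, rfl⟩ := hW _ List.mem_cons_self
    have hW' := fun q hq => hW q (List.mem_cons_of_mem _ hq)
    simp only [List.map_cons, List.flatten_cons, stackRun_append] at h
    rw [List.map_cons, freeValue_cons]
    cases b with
    | true =>
      simp only [blockWord, if_true, stackRun_codeBlock huv, Option.bind_some] at h
      have := ih hW' (x :: L) h
      simpa [blockLetter, hg, mul_assoc] using this
    | false =>
      simp only [blockWord, Bool.false_eq_true, if_false] at h
      cases L with
      | nil => simp [stackOf, stackRun_barW_codeBlock_nil huv] at h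
      | cons y L =>
        have hstack : stackOf c (y :: L) = (c y : ℤ) :: 0 :: stackOf c L := rfl
        rw [hstack, stackRun_barW_codeBlock_cons huv] at h
        by_cases hyx : c y = c x
        · obtain rfl := hc hyx
          simp only [if_true, Option.bind_some] at h
          simpa [blockLetter, hg, freeValue_barL, mul_assoc] using ih hW' L h
        · simp [hyx] at h

theorem simulatesLoopify_codeBlock {Γ : GGraph V} {u v : V} (huv : v ≠ u)
    (hΓ : ∀ a b, Γ.adj a b → a = u ∧ b = u) {c : XLetter V → ℕ} (hc : Function.Injective c)
    {g : GWord V → XLetter V} (hg : ∀ x, g (codeBlock u v (c x)) = x) :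
    SimulatesLoopify Γ (Set.range fun x => codeBlock u v (c x)) g := by
  refine simulatesLoopify_of (fun a b h => (hΓ a b h).1.trans (hΓ a b h).2.symm) ?_ ?_
  · intro x
    refine ⟨(codeBlock u v (c x), true), (codeBlock u v (c x), false), ⟨x, rfl⟩, ⟨x, rfl⟩,
      gequiv_append_barW Γ _, hg x, ?_⟩
    simp [blockLetter, hg]
  · intro parts hW h
    have h' := stackRun_eq_of_gequiv hΓ h (0, [])
    simpa using freeValue_eq_one_of_stackRun huv hc hg parts hW [] h'

theorem codeBlock_injective (u v : V) : Function.Injective (codeBlock u v) := by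
  intro m n h
  simpa [codeBlock] using congrArg List.length h

theorem exists_simulatesLoopify_of_unlooped [Finite V] {Γ : GGraph V} {u v : V} (huv : v ≠ u)
    (hΓ : ∀ a b, Γ.adj a b → a = u ∧ b = u) :
    ∃ (W : Set (GWord V)) (g : GWord V → XLetter V), W.Finite ∧
      (∀ w ∈ W, ∀ a ∈ w, a = Sum.inl u ∨ a = Sum.inl v) ∧ SimulatesLoopify Γ W g := by
  obtain ⟨c, hc⟩ := Countable.exists_injective_nat (XLetter V)
  have : Nonempty (XLetter V) := ⟨Sum.inl u⟩
  refine ⟨Set.range fun x => codeBlock u v (c x),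
    Function.invFun fun x => codeBlock u v (c x), Set.finite_range _, ?_,
    simulatesLoopify_codeBlock huv hΓ hc
      (Function.leftInverse_invFun ((codeBlock_injective u v).comp hc))⟩
  rintro _ ⟨x, rfl⟩ a ha
  simp [codeBlock] at ha
  tauto

end ValencePaper

/-- Let `Γ` have exactly two vertices `u, v`, non-adjacent (loops
arbitrary). Then there are a finite set `W ⊆ {u,v}*` and a morphism
`φ : (W ∪ W̄)* → X_Γ*` (determined by a letter `g w ∈ X_Γ` for each block `w ∈ W`,
with `φ(w̄) = φ(w)‾`) such that for all `y ∈ X_Γ*`: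
`y ≡_{Γ°} ε` iff there is `x ∈ (W ∪ W̄)*` with `x ≡_Γ ε` and `φ(x) = y`. -/
theorem simulate_free_group_two_vertices {V : Type} (Γ : GGraph V) (u v : V)
    (huv : u ≠ v) (hall : ∀ x : V, x = u ∨ x = v) (hnadj : ¬ Γ.adj u v) :
    ∃ (W : Set (GWord V)) (g : GWord V → XLetter V),
      W.Finite ∧
      (∀ w ∈ W, ∀ a ∈ w, a = Sum.inl u ∨ a = Sum.inl v) ∧
      SimulatesLoopify Γ W g := by
  have hfin : Finite V :=
    Set.finite_univ_iff.1 ((Set.toFinite {u, v}).subset fun x _ => hall x)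
  have hnadj' : ¬ Γ.adj v u := fun h => hnadj (Γ.symm _ _ h)
  by_cases hv : Γ.adj v v
  · by_cases hu : Γ.adj u u
    · refine ⟨_, _, Set.finite_range _, ?_, simulatesLoopify_singletons ?_ u⟩
      · rintro _ ⟨x, rfl⟩ a ha
        obtain rfl := List.mem_singleton.1 ha
        simpa using hall x
      · intro a b
        rcases hall a with rfl | rfl <;> rcases hall b with rfl | rfl <;>
          simp_all [eq_comm]
    · obtain ⟨W, g, hW, hWuv, h⟩ :=
        exists_simulatesLoopify_of_unlooped (Γ := Γ) (u := v) (v := u) huv <| by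
          intro a b hab
          rcases hall a with rfl | rfl <;> rcases hall b with rfl | rfl <;> simp_all
      exact ⟨W, g, hW, fun w hw a ha => (hWuv w hw a ha).symm, h⟩
  · refine exists_simulatesLoopify_of_unlooped huv.symm ?_
    intro a b hab
    rcases hall a with rfl | rfl <;> rcases hall b with rfl | rfl <;> simp_all
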